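/- There exist h₀ > 0, A₀ > 0 and β > 0 such that, writing N(h) = ∫_ℝ (Q(x) − Q(x+h))² dx + ∫_ℝ (Q'(x) − Q'(x+h))² dx for h ∈ ℝ: (i) if |h| ≤ h₀ then β·h² ≤ N(h) ≤ 4β·h², and (ii) if |h| > h₀ then N(h) > A₀. -/

import Mathlib

/-- The soliton profile `Q(x) = ((p+1)/(2 cosh²(((p−1)/2)x)))^(1/(p−1))`. -/
noncomputable def Q (p : ℕ) (x : ℝ) : ℝ :=
  (((p : ℝ) + 1) / (2 * Real.cosh ((((p : ℝ) - 1) / 2) * x) ^ 2)) ^ (1 / ((p : ℝ) - 1))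

/-- Squared `H¹` distance between `Q` and its translate by `h`. -/
noncomputable def N (p : ℕ) (h : ℝ) : ℝ :=
  (∫ x : ℝ, (Q p x - Q p (x + h)) ^ 2) + ∫ x : ℝ, (deriv (Q p) x - deriv (Q p) (x + h)) ^ 2

open MeasureTheory Filter Topology Set

theorem integrable_sq_mul_exp_neg_abs (K : ℝ) :
    Integrable (fun x : ℝ => (K * Real.exp (-|x|)) ^ 2) := by
  have key : Integrable (fun x : ℝ => Real.exp (-2 * |x|)) := by
    rw [← integrableOn_univ, ← Iic_union_Ioi (a := (0 : ℝ))]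
    refine IntegrableOn.union ?_ ?_
    · refine (integrableOn_exp_mul_Iic (a := 2) two_pos 0).congr_fun (fun x hx => ?_)
        measurableSet_Iic
      simp only [abs_of_nonpos (mem_Iic.1 hx)]
      ring_nf
    · refine (integrableOn_exp_mul_Ioi (a := -2) (by norm_num) 0).congr_fun (fun x hx => ?_)
        measurableSet_Ioi
      simp only [abs_of_pos (mem_Ioi.1 hx)]
  refine (key.const_mul (K ^ 2)).congr (Eventually.of_forall fun x => ?_)
  simp only [mul_pow, ← Real.exp_nat_mul]
  push_cast
  ring_nf

theorem integrable_sq_of_abs_le_mul_exp_neg_abs {f : ℝ → ℝ} {K : ℝ} (hf : Continuous f)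
    (hb : ∀ x, |f x| ≤ K * Real.exp (-|x|)) : Integrable (fun x => f x ^ 2) := by
  refine (integrable_sq_mul_exp_neg_abs K).mono' (by fun_prop) (Eventually.of_forall fun x => ?_)
  rw [Real.norm_of_nonneg (sq_nonneg _), ← sq_abs]
  exact pow_le_pow_left₀ (abs_nonneg _) (hb x) 2

theorem integrable_sq_sub_translate {f : ℝ → ℝ} (hf : Continuous f)
    (hi : Integrable (fun x => f x ^ 2)) (h : ℝ) :
    Integrable (fun x => (f x - f (x + h)) ^ 2) := by
  have h1 : MemLp f 2 := (memLp_two_iff_integrable_sq hf.aestronglyMeasurable).2 hi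
  have h2 : MemLp (fun x => f (x + h)) 2 :=
    (memLp_two_iff_integrable_sq (by fun_prop)).2 (hi.comp_add_right h)
  exact (h1.sub h2).integrable_sq

theorem integral_sq_sub_translate_neg (f : ℝ → ℝ) (h : ℝ) :
    ∫ x, (f x - f (x + -h)) ^ 2 = ∫ x, (f x - f (x + h)) ^ 2 := by
  rw [← integral_add_right_eq_self _ h]
  refine integral_congr_ae (Eventually.of_forall fun x => ?_)
  simp only [add_neg_cancel_right]
  ring

theorem abs_sub_translate_le_of_deriv_exp_decay {f f' : ℝ → ℝ} {K : ℝ}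
    (hd : ∀ x, HasDerivAt f (f' x) x) (hb : ∀ x, |f' x| ≤ K * Real.exp (-|x|))
    {h : ℝ} (hh : |h| ≤ 1) (x : ℝ) :
    |f x - f (x + h)| ≤ K * Real.exp 1 * Real.exp (-|x|) * |h| := by
  have hK : 0 ≤ K := by
    simpa using (abs_nonneg _).trans (hb 0)
  have hx : x ∈ Metric.closedBall x |h| := Metric.mem_closedBall_self (abs_nonneg h)
  have hxh : x + h ∈ Metric.closedBall x |h| := by simp
  have := (convex_closedBall x |h|).norm_image_sub_le_of_norm_hasDerivWithin_le
    (f := f) (f' := f') (C := K * Real.exp 1 * Real.exp (-|x|))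
    (fun y _ => (hd y).hasDerivWithinAt) (fun y hy => ?_) hxh hx
  · simpa using this
  · rw [Metric.mem_closedBall, Real.dist_eq] at hy
    refine (hb y).trans ?_
    rw [mul_assoc, ← Real.exp_add]
    gcongr
    have := abs_sub_abs_le_abs_sub x y
    rw [abs_sub_comm x y] at this
    linarith

theorem tendsto_integral_sq_sub_translate_div {f f' : ℝ → ℝ} {K : ℝ}
    (hd : ∀ x, HasDerivAt f (f' x) x) (hb : ∀ x, |f' x| ≤ K * Real.exp (-|x|)) :
    Tendsto (fun h : ℝ => (∫ x, (f x - f (x + h)) ^ 2) / h ^ 2) (𝓝[≠] 0)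
      (𝓝 (∫ x, f' x ^ 2)) := by
  have hc : Continuous f := continuous_iff_continuousAt.2 fun x => (hd x).continuousAt
  simp_rw [← integral_div]
  refine tendsto_integral_filter_of_dominated_convergence
    (fun x => (K * Real.exp 1 * Real.exp (-|x|)) ^ 2) ?_ ?_
    (integrable_sq_mul_exp_neg_abs _) ?_
  · exact Eventually.of_forall fun h => by fun_prop
  · have h1 : ∀ᶠ h : ℝ in 𝓝[≠] 0, |h| ≤ 1 := by
      refine eventually_nhdsWithin_of_eventually_nhds ?_
      filter_upwards [Metric.closedBall_mem_nhds (0 : ℝ) one_pos] with h hh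
      simpa using hh
    filter_upwards [h1, self_mem_nhdsWithin] with h hh h0
    refine Eventually.of_forall fun x => ?_
    have hpos : 0 < |h| := abs_pos.2 h0
    rw [← div_pow, Real.norm_of_nonneg (sq_nonneg _), ← sq_abs, abs_div]
    refine pow_le_pow_left₀ (by positivity) ?_ 2
    rw [div_le_iff₀ hpos]
    exact abs_sub_translate_le_of_deriv_exp_decay hd hb hh x
  · refine Eventually.of_forall fun x => ?_
    refine ((hasDerivAt_iff_tendsto_slope_zero.1 (hd x)).pow 2).congr fun h => ?_
    simp only [smul_eq_mul]
    rw [← div_pow, div_eq_inv_mul, ← neg_sq, ← mul_neg, neg_sub]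

theorem Q_pos {p : ℕ} (x : ℝ) : 0 < Q p x := by
  have := Real.cosh_pos ((((p : ℝ) - 1) / 2) * x)
  unfold Q
  positivity

theorem hasDerivAt_Q {p : ℕ} (hp : 2 ≤ p) (x : ℝ) :
    HasDerivAt (Q p) (-Real.tanh ((((p : ℝ) - 1) / 2) * x) * Q p x) x := by
  have hp' : (2 : ℝ) ≤ p := by exact_mod_cast hp
  have hp1 : (p : ℝ) - 1 ≠ 0 := by linarith
  set k : ℝ := ((p : ℝ) - 1) / 2 with hk
  have hcosh := Real.cosh_pos (k * x)
  have hl : HasDerivAt (fun x : ℝ => k * x) k x := by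
    simpa using (hasDerivAt_id x).const_mul k
  have hbase : HasDerivAt (fun x => ((p : ℝ) + 1) / (2 * Real.cosh (k * x) ^ 2)) _ x :=
    (hasDerivAt_const x ((p : ℝ) + 1)).div ((hl.cosh.pow 2).const_mul 2) (by positivity)
  have hpos : 0 < ((p : ℝ) + 1) / (2 * Real.cosh (k * x) ^ 2) := by positivity
  have := hbase.rpow_const (p := 1 / ((p : ℝ) - 1)) (Or.inl hpos.ne')
  refine this.congr_deriv ?_
  rw [Real.rpow_sub_one hpos.ne', Real.tanh_eq_sinh_div_cosh]
  change _ = _ * (((p : ℝ) + 1) / (2 * Real.cosh (k * x) ^ 2)) ^ (1 / ((p : ℝ) - 1))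
  generalize (((p : ℝ) + 1) / (2 * Real.cosh (k * x) ^ 2)) ^ (1 / ((p : ℝ) - 1)) = R
  generalize Real.cosh (k * x) = c at *
  generalize Real.sinh (k * x) = s at *
  rw [hk]
  have : (p : ℝ) + 1 ≠ 0 := by positivity
  simp
  field_simp

theorem deriv_Q {p : ℕ} (hp : 2 ≤ p) :
    deriv (Q p) = fun x => -Real.tanh ((((p : ℝ) - 1) / 2) * x) * Q p x :=
  funext fun x => (hasDerivAt_Q hp x).deriv

theorem hasDerivAt_deriv_Q {p : ℕ} (hp : 2 ≤ p) (x : ℝ) :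
    HasDerivAt (deriv (Q p)) ((Real.tanh ((((p : ℝ) - 1) / 2) * x) ^ 2
      - (((p : ℝ) - 1) / 2) * (1 - Real.tanh ((((p : ℝ) - 1) / 2) * x) ^ 2)) * Q p x) x := by
  rw [deriv_Q hp]
  set k : ℝ := ((p : ℝ) - 1) / 2 with hk
  have hl : HasDerivAt (fun x : ℝ => k * x) k x := by
    simpa using (hasDerivAt_id x).const_mul k
  have hcosh := Real.cosh_pos (k * x)
  have ht : HasDerivAt (fun x => Real.tanh (k * x)) (k * (1 - Real.tanh (k * x) ^ 2)) x := by
    simp_rw [Real.tanh_eq_sinh_div_cosh]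
    refine (hl.sinh.div hl.cosh hcosh.ne').congr_deriv ?_
    field_simp
  refine (ht.neg.mul (hasDerivAt_Q hp x)).congr_deriv ?_
  rw [← hk]
  simp only [Pi.neg_apply]
  ring

theorem Q_le_mul_exp_neg_abs {p : ℕ} (hp : 2 ≤ p) (x : ℝ) :
    Q p x ≤ (2 * ((p : ℝ) + 1)) ^ (1 / ((p : ℝ) - 1)) * Real.exp (-|x|) := by
  have hp' : (2 : ℝ) ≤ p := by exact_mod_cast hp
  have hp1 : 0 < (p : ℝ) - 1 := by linarith
  have he : Real.exp (-|x|) = Real.exp (-((p : ℝ) - 1) * |x|) ^ (1 / ((p : ℝ) - 1)) := by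
    rw [← Real.exp_mul]
    congr 1
    field_simp
  rw [he, ← Real.mul_rpow (by positivity) (by positivity)]
  unfold Q
  have hcosh := Real.cosh_pos ((((p : ℝ) - 1) / 2) * x)
  refine Real.rpow_le_rpow (by positivity) ?_ (by positivity)
  have h1 : Real.exp ((((p : ℝ) - 1) / 2) * |x|) / 2 ≤ Real.cosh ((((p : ℝ) - 1) / 2) * x) := by
    rw [← Real.cosh_abs, abs_mul, abs_of_pos (by positivity : 0 < ((p : ℝ) - 1) / 2),
      Real.cosh_eq]
    have := Real.exp_pos (-((((p : ℝ) - 1) / 2) * |x|))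
    linarith
  have h2 := pow_le_pow_left₀ (by positivity) h1 2
  have h3 : Real.exp (-((p : ℝ) - 1) * |x|) * Real.exp ((((p : ℝ) - 1) / 2) * |x|) ^ 2 = 1 := by
    rw [← Real.exp_nat_mul, ← Real.exp_add, Real.exp_eq_one_iff]
    push_cast
    ring
  rw [div_le_iff₀ (by positivity)]
  calc (p : ℝ) + 1 = ((p : ℝ) + 1) * (Real.exp (-((p : ℝ) - 1) * |x|) *
        Real.exp ((((p : ℝ) - 1) / 2) * |x|) ^ 2) := by rw [h3, mul_one]
    _ = 2 * ((p : ℝ) + 1) * Real.exp (-((p : ℝ) - 1) * |x|) *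
        (2 * (Real.exp ((((p : ℝ) - 1) / 2) * |x|) / 2) ^ 2) := by ring
    _ ≤ _ := by gcongr

theorem Q_lt_Q {p : ℕ} (hp : 2 ≤ p) {x y : ℝ} (hx : 0 ≤ x) (hxy : x < y) : Q p y < Q p x := by
  have hp' : (2 : ℝ) ≤ p := by exact_mod_cast hp
  have hp1 : 0 < (p : ℝ) - 1 := by linarith
  unfold Q
  have hcx := Real.cosh_pos ((((p : ℝ) - 1) / 2) * x)
  have hcy := Real.cosh_pos ((((p : ℝ) - 1) / 2) * y)
  refine Real.rpow_lt_rpow (by positivity) ?_ (by positivity)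
  have : Real.cosh ((((p : ℝ) - 1) / 2) * x) < Real.cosh ((((p : ℝ) - 1) / 2) * y) := by
    rw [Real.cosh_lt_cosh, abs_of_nonneg (by positivity),
      abs_of_nonneg (mul_nonneg (by positivity) (hx.trans hxy.le))]
    gcongr
  gcongr

/-- Effect of small translations on `Q`: there are `h₀, A₀, β > 0` with
`β h² ≤ ‖Q − Q(·+h)‖²_{H¹} ≤ 4β h²` for `|h| ≤ h₀`, and `‖Q − Q(·+h)‖²_{H¹} > A₀`
for `|h| > h₀`. -/
theorem stmt13 (p : ℕ) (hp : 2 ≤ p) :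
    ∃ h₀ A₀ β : ℝ, 0 < h₀ ∧ 0 < A₀ ∧ 0 < β ∧
      ∀ h : ℝ,
        (|h| ≤ h₀ → β * h ^ 2 ≤ N p h ∧ N p h ≤ 4 * β * h ^ 2) ∧
        (h₀ < |h| → A₀ < N p h) := by
  have hp' : (2 : ℝ) ≤ p := by exact_mod_cast hp
  set k : ℝ := ((p : ℝ) - 1) / 2 with hk
  have hk0 : 0 < k := by rw [hk]; linarith
  set K : ℝ := (2 * ((p : ℝ) + 1)) ^ (1 / ((p : ℝ) - 1)) with hK
  have hQc : Continuous (Q p) :=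
    continuous_iff_continuousAt.2 fun x => (hasDerivAt_Q hp x).continuousAt
  have hdc : Continuous (deriv (Q p)) :=
    continuous_iff_continuousAt.2 fun x => (hasDerivAt_deriv_Q hp x).continuousAt
  have hQb : ∀ x, |Q p x| ≤ K * Real.exp (-|x|) := fun x => by
    rw [abs_of_pos (Q_pos x)]
    exact Q_le_mul_exp_neg_abs hp x
  have hdb : ∀ x, |deriv (Q p) x| ≤ K * Real.exp (-|x|) := fun x => by
    refine le_trans ?_ (hQb x)
    rw [deriv_Q hp, abs_mul, abs_neg]
    exact mul_le_of_le_one_left (abs_nonneg _) (Real.abs_tanh_lt_one _).le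
  have hddb : ∀ x, |(Real.tanh (k * x) ^ 2 - k * (1 - Real.tanh (k * x) ^ 2)) * Q p x|
      ≤ (1 + k) * K * Real.exp (-|x|) := fun x => by
    rw [abs_mul, mul_assoc (1 + k)]
    refine mul_le_mul ?_ (hQb x) (abs_nonneg _) (by positivity)
    have h1 := (Real.tanh_sq_lt_one (k * x)).le
    have h2 := sq_nonneg (Real.tanh (k * x))
    rw [abs_le]
    constructor <;> nlinarith
  have hlim : Tendsto (fun h => N p h / h ^ 2) (𝓝[≠] 0) (𝓝 ((∫ x, deriv (Q p) x ^ 2) +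
      ∫ x, ((Real.tanh (k * x) ^ 2 - k * (1 - Real.tanh (k * x) ^ 2)) * Q p x) ^ 2)) := by
    simp only [N, add_div]
    exact (tendsto_integral_sq_sub_translate_div
      (fun x => (hasDerivAt_Q hp x).differentiableAt.hasDerivAt) hdb).add
      (tendsto_integral_sq_sub_translate_div (hasDerivAt_deriv_Q hp) hddb)
  set L := (∫ x, deriv (Q p) x ^ 2) +
      ∫ x, ((Real.tanh (k * x) ^ 2 - k * (1 - Real.tanh (k * x) ^ 2)) * Q p x) ^ 2 with hL
  have hLpos : 0 < L := by
    refine add_pos_of_pos_of_nonneg ?_ (integral_nonneg fun x => sq_nonneg _)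
    rw [integral_pos_iff_support_of_nonneg (fun x => sq_nonneg _)
      (integrable_sq_of_abs_le_mul_exp_neg_abs hdc hdb)]
    refine (hdc.pow 2).isOpen_support.measure_pos _ ⟨1, ?_⟩
    have ht : Real.tanh (k * 1) ≠ 0 := by
      rw [Real.tanh_eq_sinh_div_cosh]
      exact div_ne_zero (Real.sinh_pos_iff.2 (by linarith)).ne' (Real.cosh_pos _).ne'
    rw [Function.mem_support, deriv_Q hp]
    exact pow_ne_zero _ (mul_ne_zero (neg_ne_zero.2 ht) (Q_pos 1).ne')
  have hnear : ∀ᶠ h in 𝓝[≠] (0 : ℝ), N p h / h ^ 2 ∈ Ioo (L / 2) (2 * L) :=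
    hlim (Ioo_mem_nhds (by linarith) (by linarith))
  obtain ⟨r, hr, hball⟩ := Metric.eventually_nhds_iff.1 (eventually_nhdsWithin_iff.1 hnear)
  have hQi := integrable_sq_of_abs_le_mul_exp_neg_abs hQc hQb
  have hlow : ∀ h, r / 2 < h →
      ∫ x in (0 : ℝ)..1, (Q p x - Q p (x + r / 2)) ^ 2 ≤ N p h := fun h hh => by
    have hi := integrable_sq_sub_translate hQc hQi h
    have hi' := integrable_sq_sub_translate hQc hQi (r / 2)
    rw [intervalIntegral.integral_of_le zero_le_one]
    calc ∫ x in Ioc (0 : ℝ) 1, (Q p x - Q p (x + r / 2)) ^ 2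
        ≤ ∫ x in Ioc (0 : ℝ) 1, (Q p x - Q p (x + h)) ^ 2 := by
          refine setIntegral_mono_on hi'.integrableOn hi.integrableOn measurableSet_Ioc
            fun x hx => ?_
          have h1 := Q_lt_Q hp (x := x + r / 2) (y := x + h) (by linarith [hx.1]) (by linarith)
          have h2 := Q_lt_Q hp (x := x) (y := x + r / 2) hx.1.le (by linarith)
          exact pow_le_pow_left₀ (by linarith) (by linarith) 2
      _ ≤ ∫ x, (Q p x - Q p (x + h)) ^ 2 :=
          setIntegral_le_integral hi (Eventually.of_forall fun x => sq_nonneg _)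
      _ ≤ N p h := le_add_of_nonneg_right (integral_nonneg fun x => sq_nonneg _)
  have hA : 0 < ∫ x in (0 : ℝ)..1, (Q p x - Q p (x + r / 2)) ^ 2 := by
    refine intervalIntegral.intervalIntegral_pos_of_pos_on
      (Continuous.intervalIntegrable (by fun_prop) _ _) (fun x hx => ?_) zero_lt_one
    have h2 := Q_lt_Q hp (x := x) (y := x + r / 2) hx.1.le (by linarith)
    exact pow_pos (by linarith) 2
  have hsymm : ∀ h, N p (-h) = N p h := fun h => by
    simp only [N, integral_sq_sub_translate_neg]
  refine ⟨r / 2, (∫ x in (0 : ℝ)..1, (Q p x - Q p (x + r / 2)) ^ 2) / 2, L / 2,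
    by linarith, by linarith, by linarith, fun h => ⟨fun hh => ?_, fun hh => ?_⟩⟩
  · rcases eq_or_ne h 0 with rfl | h0
    · simp [N]
    · have hN := hball (y := h) (by rw [Real.dist_eq, sub_zero]; linarith) h0
      have hpos : 0 < h ^ 2 := by positivity
      rw [mem_Ioo, lt_div_iff₀ hpos, div_lt_iff₀ hpos] at hN
      exact ⟨hN.1.le, by linarith [hN.2]⟩
  · have : N p |h| = N p h := by
      rcases abs_choice h with h' | h' <;> rw [h']
      exact hsymm h
    rw [← this]
    linarith [hlow _ hh]
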